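/- Fix γ ∈ (−1,1) and let w_* be one of the two domain walls w_*^±. There exist δ′ > 0 and C′ > 0 such that: (i) if g, g̃ ∈ ℝ² satisfy ‖g.w_* − g̃.w_*‖_{H¹} ≤ δ′, then there exists n ∈ ℤ with |g − (g̃ + (0, 2πn))| ≤ C′·‖g.w_* − g̃.w_*‖_{H¹}; (ii) moreover, if g, g̃ : [0,T] → ℝ² are continuous and ‖g(t).w_* − g̃(t).w_*‖_{H¹} ≤ δ′ for every t ∈ [0,T], then there is a single n ∈ ℤ, independent of t, such that |g(t) − (g̃(t) + (0, 2πn))| ≤ C′·‖g(t).w_* − g̃(t).w_*‖_{H¹} for every t ∈ [0,T]. -/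

import Mathlib

open MeasureTheory Filter ENNReal

noncomputable section

abbrev E3 := EuclideanSpace ℝ (Fin 3)

/-- canonical basis vectors of ℝ³ -/
def e1 : E3 := !₂[1, 0, 0]
def e2 : E3 := !₂[0, 1, 0]
def e3 : E3 := !₂[0, 0, 1]

/-- cross product in ℝ³ -/
def cross3 (a b : E3) : E3 :=
  !₂[a 1 * b 2 - a 2 * b 1, a 2 * b 0 - a 0 * b 2, a 0 * b 1 - a 1 * b 0]

/-- scalar product in ℝ³ -/
def dot3 (a b : E3) : ℝ := a 0 * b 0 + a 1 * b 1 + a 2 * b 2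

/-- θ_*(x) = 2 arctan (exp (−√(1−γ²) x)) -/
def thetaStar (γ x : ℝ) : ℝ := 2 * Real.arctan (Real.exp (-Real.sqrt (1 - γ ^ 2) * x))

/-- φ_*(x) = −γ x -/
def phiStar (γ x : ℝ) : ℝ := -γ * x

/-- the domain walls w_*^± (s = ±1 is the sign) -/
def wStar (γ s x : ℝ) : E3 :=
  !₂[Real.cos (thetaStar γ x),
    s * (Real.sin (thetaStar γ x) * Real.cos (phiStar γ x)),
    s * (Real.sin (thetaStar γ x) * Real.sin (phiStar γ x))]

/-- rotation about the axis e₁ by angle φ -/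
def rot (φ : ℝ) (v : E3) : E3 :=
  !₂[v 0, v 1 * Real.cos φ - v 2 * Real.sin φ, v 1 * Real.sin φ + v 2 * Real.cos φ]

/-- the energy gradient δE(m) = −m″ − 2γ e₁ ∧ m′ + m₂e₂ + m₃e₃ -/
def deltaE (γ : ℝ) (m : ℝ → E3) (x : ℝ) : E3 :=
  -(deriv (deriv m) x) - (2 * γ) • cross3 e1 (deriv m x) + (m x 1) • e2 + (m x 2) • e3

/-- the L² norm of a function on ℝ -/
def L2norm {E : Type*} [NormedAddCommGroup E] (u : ℝ → E) : ℝ :=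
  (eLpNorm u 2 volume).toReal

/-- the H¹ norm ‖u‖_{L²} + ‖u′‖_{L²} -/
def H1norm {E : Type*} [NormedAddCommGroup E] [NormedSpace ℝ E] (u : ℝ → E) : ℝ :=
  L2norm u + L2norm (deriv u)

/-- the ℋ¹ seminorm ‖m₂‖_{L²} + ‖m₃‖_{L²} + ‖m′‖_{L²} -/
def HH1 (m : ℝ → E3) : ℝ :=
  L2norm (fun x => m x 1) + L2norm (fun x => m x 2) + L2norm (deriv m)

/-- the micromagnetic energy E(m) -/
def energy (γ : ℝ) (m : ℝ → E3) : ℝ :=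
  (1 / 2) * ∫ x : ℝ,
    (‖deriv m x‖ ^ 2 + 2 * γ * dot3 (deriv m x) (cross3 e1 (m x)) + (1 - (m x 0) ^ 2))

/-- the gauge action (g.m)(x) = R_φ m(x − y) for g = (y,φ) -/
def gact (g : ℝ × ℝ) (m : ℝ → E3) : ℝ → E3 := fun x => rot g.2 (m (x - g.1))


theorem gc_const (T : ℝ) (ψ : ℝ → ℝ) (hψ : ContinuousOn ψ (Set.Icc 0 T)) (n : ℝ → ℤ)
    (hn : ∀ t ∈ Set.Icc (0:ℝ) T, |ψ t - 2 * Real.pi * n t| ≤ 1) :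
    ∀ t ∈ Set.Icc (0:ℝ) T, n t = n 0 := by
  intro t ht
  have h0 : (0:ℝ) ∈ Set.Icc (0:ℝ) T := ⟨le_refl _, ht.1.trans ht.2⟩
  have hpi := Real.pi_gt_three
  have far : ∀ u ∈ Set.Icc (0:ℝ) T, n u ≠ n 0 → 5 ≤ |ψ u - 2 * Real.pi * n 0| := by
    intro u hu hne
    have h1 : (1:ℝ) ≤ |(n u : ℝ) - n 0| := by
      have : (1:ℤ) ≤ |n u - n 0| := Int.one_le_abs (sub_ne_zero.2 hne)
      exact_mod_cast this
    have h2 : |2 * Real.pi * ((n u : ℝ) - n 0)| ≥ 6 := by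
      rw [abs_mul, abs_of_pos (by positivity)]
      nlinarith
    have h3 : 2 * Real.pi * ((n u : ℝ) - n 0) =
        (ψ u - 2 * Real.pi * n 0) - (ψ u - 2 * Real.pi * n u) := by ring
    rw [h3] at h2
    have := abs_sub (ψ u - 2 * Real.pi * n 0) (ψ u - 2 * Real.pi * n u)
    have := hn u hu
    linarith
  by_contra hne
  have hc : ContinuousOn (fun u => |ψ u - 2 * Real.pi * n 0|) (Set.Icc 0 T) :=
    (hψ.sub continuousOn_const).abs
  have hiv := isPreconnected_Icc.intermediate_value h0 ht hc
  obtain ⟨u, hu, hu2⟩ := hiv (show (2:ℝ) ∈ Set.Icc _ _ from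
    ⟨by have := hn 0 h0; linarith, by have := far t ht hne; linarith⟩)
  simp only at hu2
  by_cases h : n u = n 0
  · have := hn u hu
    rw [h] at this
    linarith
  · have := far u hu h
    linarith

def gcTh (x : ℝ) : ℝ := Real.sinh x / Real.cosh x

theorem gcTh_sub (A B : ℝ) :
    gcTh A - gcTh B = Real.sinh (A - B) / (Real.cosh A * Real.cosh B) := by
  have := (Real.cosh_pos A).ne'
  have := (Real.cosh_pos B).ne'
  unfold gcTh
  rw [Real.sinh_sub]
  field_simp

theorem gcTh_mono : Monotone gcTh := by
  intro A B h
  rw [← sub_nonneg, gcTh_sub]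
  have := (Real.cosh_pos A)
  have := (Real.cosh_pos B)
  have : 0 ≤ Real.sinh (B - A) := Real.sinh_nonneg_iff.2 (by linarith)
  positivity

theorem gc_cos (γ x : ℝ) : Real.cos (thetaStar γ x) = gcTh (Real.sqrt (1 - γ ^ 2) * x) := by
  unfold thetaStar gcTh
  rw [Real.cos_two_mul, Real.cos_sq_arctan, Real.sinh_eq, Real.cosh_eq, neg_mul]
  set b := Real.sqrt (1 - γ ^ 2) * x
  have h1 : Real.exp b = (Real.exp (-b))⁻¹ := by rw [Real.exp_neg, inv_inv]
  have h2 := Real.exp_pos (-b)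
  rw [h1]
  field_simp
  ring

theorem gc_sin (γ x : ℝ) : Real.sin (thetaStar γ x) =
    (Real.cosh (Real.sqrt (1 - γ ^ 2) * x))⁻¹ := by
  unfold thetaStar
  rw [Real.sin_two_mul, Real.sin_arctan, Real.cos_arctan, Real.cosh_eq, neg_mul]
  set b := Real.sqrt (1 - γ ^ 2) * x
  have h1 : Real.exp b = (Real.exp (-b))⁻¹ := by rw [Real.exp_neg, inv_inv]
  have h2 := Real.exp_pos (-b)
  rw [h1]
  have h3 : 0 < 1 + Real.exp (-b) ^ 2 := by positivity
  have h4 : Real.sqrt (1 + Real.exp (-b) ^ 2) ^ 2 = 1 + Real.exp (-b) ^ 2 := Real.sq_sqrt h3.le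
  have h5 := Real.sqrt_pos.2 h3
  generalize Real.exp (-b) = e at *
  generalize Real.sqrt (1 + e ^ 2) = r at *
  field_simp
  rw [h4]

theorem gc_form (γ s : ℝ) (g g' : ℝ × ℝ) (x : ℝ) :
    gact g (wStar γ s) x - gact g' (wStar γ s) x =
    !₂[gcTh (Real.sqrt (1 - γ ^ 2) * (x - g.1)) - gcTh (Real.sqrt (1 - γ ^ 2) * (x - g'.1)),
      s * ((Real.cosh (Real.sqrt (1 - γ ^ 2) * (x - g.1)))⁻¹ * Real.cos (g.2 - γ * (x - g.1)) -
        (Real.cosh (Real.sqrt (1 - γ ^ 2) * (x - g'.1)))⁻¹ * Real.cos (g'.2 - γ * (x - g'.1))),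
      s * ((Real.cosh (Real.sqrt (1 - γ ^ 2) * (x - g.1)))⁻¹ * Real.sin (g.2 - γ * (x - g.1)) -
        (Real.cosh (Real.sqrt (1 - γ ^ 2) * (x - g'.1)))⁻¹ * Real.sin (g'.2 - γ * (x - g'.1)))] := by
  ext i
  fin_cases i
  · simp [gact, rot, wStar, gc_cos]
  · simp [gact, rot, wStar, gc_sin, phiStar, Real.cos_sub]
    ring
  · simp [gact, rot, wStar, gc_sin, phiStar, Real.sin_sub]
    ring

theorem gc_normsq (a b c : ℝ) : ‖(!₂[a, b, c] : E3)‖ ^ 2 = a ^ 2 + b ^ 2 + c ^ 2 := by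
  rw [EuclideanSpace.norm_sq_eq]
  simp [Fin.sum_univ_three]

theorem gc_norm_le (a b c : ℝ) : ‖(!₂[a, b, c] : E3)‖ ≤ |a| + |b| + |c| := by
  refine (pow_le_pow_iff_left₀ (by positivity) (by positivity) two_ne_zero).1 ?_
  rw [gc_normsq, ← sq_abs a, ← sq_abs b, ← sq_abs c]
  nlinarith [mul_nonneg (abs_nonneg a) (abs_nonneg b), mul_nonneg (abs_nonneg a) (abs_nonneg c),
    mul_nonneg (abs_nonneg c) (abs_nonneg b)]

theorem gc_cosh_memLp (a y : ℝ) (ha : 0 < a) :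
    MemLp (fun x : ℝ => (Real.cosh (a * (x - y)))⁻¹) 2 volume := by
  have hc : Continuous (fun x : ℝ => (Real.cosh (a * (x - y)))⁻¹) :=
    Continuous.inv₀ (by fun_prop) (fun x => (Real.cosh_pos _).ne')
  rw [memLp_two_iff_integrable_sq hc.aestronglyMeasurable]
  have h1 : Integrable (fun x : ℝ => (1 + (a * (x - y)) ^ 2)⁻¹) :=
    (integrable_inv_one_add_sq.comp_mul_left' ha.ne').comp_sub_right y
  refine h1.mono' (hc.pow 2).aestronglyMeasurable (Filter.Eventually.of_forall fun x => ?_)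
  rw [Real.norm_of_nonneg (by positivity), inv_pow]
  apply inv_anti₀ (by positivity)
  rw [Real.cosh_sq]
  have : |a * (x - y)| ≤ |Real.sinh (a * (x - y))| := by
    rw [Real.abs_sinh]
    exact Real.self_le_sinh_iff.2 (abs_nonneg _)
  have := sq_le_sq.2 this
  linarith

theorem gc_memLp (γ s : ℝ) (ha0 : 0 < Real.sqrt (1 - γ ^ 2)) (g g' : ℝ × ℝ) :
    MemLp (fun x => gact g (wStar γ s) x - gact g' (wStar γ s) x) 2 volume := by
  simp only [gc_form]
  set a := Real.sqrt (1 - γ ^ 2)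
  have hp := gc_cosh_memLp a g.1 ha0
  have hq := gc_cosh_memLp a g'.1 ha0
  have hth : Continuous gcTh :=
    Real.continuous_sinh.div Real.continuous_cosh (fun x => (Real.cosh_pos _).ne')
  have hcc : ∀ y, Continuous (fun x : ℝ => (Real.cosh (a * (x - y)))⁻¹) := fun y =>
    Continuous.inv₀ (by fun_prop) (fun x => (Real.cosh_pos _).ne')
  have hc1 := hcc g.1
  have hc2 := hcc g'.1
  set K := |Real.sinh (a * (g'.1 - g.1))| with hK
  have hbound := ((hp.const_mul (K + 2 * |s|)).add (hq.const_mul (2 * |s|)))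
  refine hbound.mono' ?_ (Filter.Eventually.of_forall fun x => ?_)
  · apply Continuous.aestronglyMeasurable
    refine (PiLp.continuous_toLp 2 _).comp ?_
    refine continuous_pi fun i => ?_
    fin_cases i
    · simp; fun_prop
    · simp; fun_prop
    · simp; fun_prop
  · refine (gc_norm_le _ _ _).trans ?_
    simp only [Pi.add_apply]
    have hA := Real.cosh_pos (a * (x - g.1))
    have hB := Real.cosh_pos (a * (x - g'.1))
    have e1 : |gcTh (a * (x - g.1)) - gcTh (a * (x - g'.1))| ≤
        K * (Real.cosh (a * (x - g.1)))⁻¹ := by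
      rw [gcTh_sub, abs_div, abs_of_pos (mul_pos hA hB),
        show a * (x - g.1) - a * (x - g'.1) = a * (g'.1 - g.1) by ring, ← hK, div_eq_mul_inv]
      apply mul_le_mul_of_nonneg_left _ (abs_nonneg _)
      apply inv_anti₀ hA
      nlinarith [Real.one_le_cosh (a * (x - g'.1))]
    have e2 : ∀ p q c d : ℝ, 0 ≤ p → 0 ≤ q → |c| ≤ 1 → |d| ≤ 1 →
        |s * (p * c - q * d)| ≤ |s| * p + |s| * q := by
      intro p q c d hp hq hc hd
      rw [abs_mul, ← mul_add]
      apply mul_le_mul_of_nonneg_left _ (abs_nonneg _)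
      refine (abs_sub _ _).trans ?_
      rw [abs_mul, abs_mul, abs_of_nonneg hp, abs_of_nonneg hq]
      nlinarith
    have e3 := e2 _ _ _ _ (inv_pos.2 hA).le (inv_pos.2 hB).le
      (Real.abs_cos_le_one (g.2 - γ * (x - g.1))) (Real.abs_cos_le_one (g'.2 - γ * (x - g'.1)))
    have e4 := e2 _ _ _ _ (inv_pos.2 hA).le (inv_pos.2 hB).le
      (Real.abs_sin_le_one (g.2 - γ * (x - g.1))) (Real.abs_sin_le_one (g'.2 - γ * (x - g'.1)))
    linarith

theorem gc_L2_lower (f : ℝ → E3) (hf : MemLp f 2 volume) (c y : ℝ) (hc : 0 ≤ c)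
    (h : ∀ x ∈ Set.Icc y (y + 1), c ≤ ‖f x‖) : c ≤ L2norm f := by
  have h1 : eLpNorm ((Set.Icc y (y + 1)).indicator (fun _ => c)) 2 volume ≤
      eLpNorm f 2 volume := by
    apply eLpNorm_mono
    intro x
    by_cases hx : x ∈ Set.Icc y (y + 1)
    · rw [Set.indicator_of_mem hx, Real.norm_of_nonneg hc]; exact h x hx
    · rw [Set.indicator_of_notMem hx]; simp
  rw [eLpNorm_indicator_const measurableSet_Icc (by norm_num) (by norm_num)] at h1
  have h2 := ENNReal.toReal_mono hf.2.ne h1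
  unfold L2norm
  simpa [abs_of_nonneg hc] using h2

theorem gc_cosh_le (a z : ℝ) (ha0 : 0 < a) (ha1 : a ≤ 1) (hz : |z| ≤ 2) :
    Real.cosh (a * z) ≤ Real.cosh 2 := by
  rw [Real.cosh_le_cosh, abs_mul, abs_of_pos ha0, abs_two]
  nlinarith [abs_nonneg z]

theorem gc_th_lower (a h z : ℝ) (ha0 : 0 < a) (ha1 : a ≤ 1) (hh : |h| ≤ 1)
    (hz : z ∈ Set.Icc (0:ℝ) 1) :
    a / Real.cosh 2 ^ 2 * |h| ≤ |gcTh (a * (z - h)) - gcTh (a * z)| := by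
  have hA := Real.cosh_pos (a * (z - h))
  have hB := Real.cosh_pos (a * z)
  have h' := abs_le.1 hh
  have hA2 := gc_cosh_le a (z - h) ha0 ha1 (abs_le.2 ⟨by linarith [hz.1], by linarith [hz.2]⟩)
  have hB2 := gc_cosh_le a z ha0 ha1 (abs_le.2 ⟨by linarith [hz.1], by linarith [hz.2]⟩)
  rw [gcTh_sub, abs_div, abs_of_pos (mul_pos hA hB), Real.abs_sinh,
    show a * (z - h) - a * z = -(a * h) by ring, abs_neg, abs_mul, abs_of_pos ha0, div_mul_eq_mul_div]
  apply div_le_div₀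
  · exact Real.sinh_nonneg_iff.2 (by positivity)
  · exact Real.self_le_sinh_iff.2 (by positivity)
  · positivity
  · rw [sq]; exact mul_le_mul hA2 hB2 hB.le (by positivity)

theorem gc_th_lower' (a h z : ℝ) (ha0 : 0 < a) (ha1 : a ≤ 1)
    (hz : z ∈ Set.Icc (0:ℝ) 1) :
    a / Real.cosh 2 ^ 2 * min 1 |h| ≤ |gcTh (a * (z - h)) - gcTh (a * z)| := by
  rcases le_total |h| 1 with hh | hh
  · rw [min_eq_right hh]; exact gc_th_lower a h z ha0 ha1 hh hz
  · rw [min_eq_left hh]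
    rcases le_abs.1 hh with h1 | h1
    · have k := gc_th_lower a 1 z ha0 ha1 (by simp) hz
      rw [abs_one] at k
      have m1 : gcTh (a * (z - 1)) ≤ gcTh (a * z) := gcTh_mono (by nlinarith)
      have m2 : gcTh (a * (z - h)) ≤ gcTh (a * (z - 1)) := gcTh_mono (by nlinarith)
      rw [abs_of_nonpos (by linarith)] at k ⊢
      linarith
    · have k := gc_th_lower a (-1) z ha0 ha1 (by simp) hz
      rw [abs_neg, abs_one] at k
      have m1 : gcTh (a * z) ≤ gcTh (a * (z - (-1))) := gcTh_mono (by nlinarith)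
      have m2 : gcTh (a * (z - (-1))) ≤ gcTh (a * (z - h)) := gcTh_mono (by nlinarith)
      rw [abs_of_nonneg (by linarith)] at k ⊢
      linarith

theorem gc_lower_shift (γ s : ℝ) (ha0 : 0 < Real.sqrt (1 - γ ^ 2))
    (ha1 : Real.sqrt (1 - γ ^ 2) ≤ 1) (g g' : ℝ × ℝ) :
    Real.sqrt (1 - γ ^ 2) / Real.cosh 2 ^ 2 * min 1 |g.1 - g'.1| ≤
      L2norm (fun x => gact g (wStar γ s) x - gact g' (wStar γ s) x) := by
  apply gc_L2_lower _ (gc_memLp γ s ha0 g g') _ g'.1 (by positivity)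
  intro x hx
  have k := gc_th_lower' _ (g.1 - g'.1) (x - g'.1) ha0 ha1 ⟨by linarith [hx.1], by linarith [hx.2]⟩
  rw [show x - g'.1 - (g.1 - g'.1) = x - g.1 by ring] at k
  refine k.trans ?_
  rw [gc_form]
  refine (pow_le_pow_iff_left₀ (by positivity) (by positivity) two_ne_zero).1 ?_
  rw [gc_normsq, sq_abs, add_assoc]
  exact le_add_of_nonneg_right (by positivity)

theorem gc_lower_angle (γ s : ℝ) (hs : s ^ 2 = 1) (ha0 : 0 < Real.sqrt (1 - γ ^ 2))
    (ha1 : Real.sqrt (1 - γ ^ 2) ≤ 1) (g g' : ℝ × ℝ) (hh : |g.1 - g'.1| ≤ 1) :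
    ∃ n : ℤ, 2 / (Real.pi * Real.cosh 2) *
        |g.2 - g'.2 + γ * (g.1 - g'.1) - 2 * Real.pi * n| ≤
      L2norm (fun x => gact g (wStar γ s) x - gact g' (wStar γ s) x) := by
  have hpi := Real.pi_pos
  set α := g.2 - g'.2 + γ * (g.1 - g'.1) with hα
  set n := round (α / (2 * Real.pi)) with hn
  refine ⟨n, ?_⟩
  set β := α - 2 * Real.pi * n with hβ
  have hβ1 : |β| ≤ Real.pi := by
    have h1 := abs_sub_round (α / (2 * Real.pi))
    have h2 : β = 2 * Real.pi * (α / (2 * Real.pi) - n) := by rw [hβ]; field_simp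
    rw [h2, abs_mul, abs_of_pos (by positivity)]
    nlinarith
  have hcosβ : Real.cos β = Real.cos α := by
    rw [hβ, show 2 * Real.pi * (n:ℝ) = n * (2 * Real.pi) by ring, Real.cos_sub_int_mul_two_pi]
  have hq := Real.cos_le_one_sub_mul_cos_sq hβ1
  rw [hcosβ] at hq
  have hK := Real.cosh_pos 2
  apply gc_L2_lower _ (gc_memLp γ s ha0 g g') _ g'.1 (by positivity)
  intro x hx
  rw [gc_form]
  refine (pow_le_pow_iff_left₀ (by positivity) (by positivity) two_ne_zero).1 ?_
  rw [gc_normsq]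
  have h' := abs_le.1 hh
  have hA2 := gc_cosh_le _ (x - g.1) ha0 ha1
    (abs_le.2 ⟨by linarith [hx.1], by linarith [hx.2]⟩)
  have hB2 := gc_cosh_le _ (x - g'.1) ha0 ha1
    (abs_le.2 ⟨by linarith [hx.1], by linarith [hx.2]⟩)
  have hA := Real.cosh_pos (Real.sqrt (1 - γ ^ 2) * (x - g.1))
  have hB := Real.cosh_pos (Real.sqrt (1 - γ ^ 2) * (x - g'.1))
  have hp := inv_anti₀ hA hA2
  have hq' := inv_anti₀ hB hB2
  generalize gcTh (Real.sqrt (1 - γ ^ 2) * (x - g.1)) -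
    gcTh (Real.sqrt (1 - γ ^ 2) * (x - g'.1)) = D
  generalize (Real.cosh (Real.sqrt (1 - γ ^ 2) * (x - g.1)))⁻¹ = p at *
  generalize (Real.cosh (Real.sqrt (1 - γ ^ 2) * (x - g'.1)))⁻¹ = q at *
  have hα2 : Real.cos α = Real.cos (g.2 - γ * (x - g.1)) * Real.cos (g'.2 - γ * (x - g'.1)) +
      Real.sin (g.2 - γ * (x - g.1)) * Real.sin (g'.2 - γ * (x - g'.1)) := by
    rw [← Real.cos_sub]; congr 1; rw [hα]; ring
  have s1 := Real.sin_sq_add_cos_sq (g.2 - γ * (x - g.1))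
  have s2 := Real.sin_sq_add_cos_sq (g'.2 - γ * (x - g'.1))
  have hexp : ∀ c1 c2 d1 d2 : ℝ, d1 ^ 2 + c1 ^ 2 = 1 → d2 ^ 2 + c2 ^ 2 = 1 →
      D ^ 2 + (s * (p * c1 - q * c2)) ^ 2 + (s * (p * d1 - q * d2)) ^ 2 =
      D ^ 2 + ((p - q) ^ 2 + 2 * (p * q) * (1 - (c1 * c2 + d1 * d2))) := by
    intro c1 c2 d1 d2 h1 h2
    linear_combination ((p * c1 - q * c2) ^ 2 + (p * d1 - q * d2) ^ 2) * hs + p ^ 2 * h1 + q ^ 2 * h2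
  rw [hexp _ _ _ _ s1 s2, ← hα2]
  have hKi := inv_pos.2 hK
  have hpq : (Real.cosh 2)⁻¹ * (Real.cosh 2)⁻¹ ≤ p * q :=
    mul_le_mul hp hq' hKi.le (hKi.le.trans hp)
  have hβ0 : 0 ≤ 2 / Real.pi ^ 2 * β ^ 2 := by positivity
  have step : (Real.cosh 2)⁻¹ * (Real.cosh 2)⁻¹ * (2 / Real.pi ^ 2 * β ^ 2) ≤
      p * q * (1 - Real.cos α) :=
    mul_le_mul hpq (by linarith) hβ0 (le_trans (by positivity) hpq)
  have e : (2 / (Real.pi * Real.cosh 2) * |β|) ^ 2 =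
      2 * ((Real.cosh 2)⁻¹ * (Real.cosh 2)⁻¹ * (2 / Real.pi ^ 2 * β ^ 2)) := by
    rw [mul_pow, sq_abs]; field_simp
  rw [e]
  nlinarith [sq_nonneg D, sq_nonneg (p - q)]

/-- comparison of gauges acting on the domain wall, up to a multiple of 2π
    in the rotation angle, pointwise in (i) and uniformly in time in (ii). -/
theorem gauge_comparison (γ : ℝ) (hγ : -1 < γ ∧ γ < 1) (s : ℝ) (hs : s = 1 ∨ s = -1) :
    ∃ δ' C' : ℝ, 0 < δ' ∧ 0 < C' ∧
      (∀ g g' : ℝ × ℝ,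
        H1norm (fun x => gact g (wStar γ s) x - gact g' (wStar γ s) x) ≤ δ' →
        ∃ n : ℤ,
          Real.sqrt ((g.1 - g'.1) ^ 2 + (g.2 - (g'.2 + 2 * Real.pi * n)) ^ 2)
            ≤ C' * H1norm (fun x => gact g (wStar γ s) x - gact g' (wStar γ s) x)) ∧
      (∀ T : ℝ, ∀ g g' : ℝ → ℝ × ℝ,
        ContinuousOn g (Set.Icc 0 T) → ContinuousOn g' (Set.Icc 0 T) →
        (∀ t ∈ Set.Icc (0:ℝ) T,
          H1norm (fun x => gact (g t) (wStar γ s) x - gact (g' t) (wStar γ s) x) ≤ δ') →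
        ∃ n : ℤ, ∀ t ∈ Set.Icc (0:ℝ) T,
          Real.sqrt (((g t).1 - (g' t).1) ^ 2 + ((g t).2 - ((g' t).2 + 2 * Real.pi * n)) ^ 2)
            ≤ C' * H1norm (fun x => gact (g t) (wStar γ s) x - gact (g' t) (wStar γ s) x)) := by
  set a := Real.sqrt (1 - γ ^ 2) with ha
  have ha0 : 0 < a := Real.sqrt_pos.2 (by nlinarith [hγ.1, hγ.2])
  have ha1 : a ≤ 1 := Real.sqrt_le_one.2 (by nlinarith [sq_nonneg γ])
  have hs2 : s ^ 2 = 1 := by rcases hs with h | h <;> rw [h] <;> norm_num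
  have hK : 0 < Real.cosh 2 := Real.cosh_pos 2
  set c₁ : ℝ := a / Real.cosh 2 ^ 2 with hc₁
  set c₂ : ℝ := 2 / (Real.pi * Real.cosh 2) with hc₂
  have hc₁0 : 0 < c₁ := by positivity
  have hc₂0 : 0 < c₂ := by have := Real.pi_pos; positivity
  set C : ℝ := 2 / c₁ + 1 / c₂ with hC
  have hC0 : 0 < C := by positivity
  have key : ∀ g g' : ℝ × ℝ,
        H1norm (fun x => gact g (wStar γ s) x - gact g' (wStar γ s) x) ≤ min (c₁ / 2) (1 / C) →
        ∃ n : ℤ,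
          Real.sqrt ((g.1 - g'.1) ^ 2 + (g.2 - (g'.2 + 2 * Real.pi * n)) ^ 2)
            ≤ C * H1norm (fun x => gact g (wStar γ s) x - gact g' (wStar γ s) x) := by
    intro g g' h
    have hle : L2norm (fun x => gact g (wStar γ s) x - gact g' (wStar γ s) x) ≤
        H1norm (fun x => gact g (wStar γ s) x - gact g' (wStar γ s) x) := by
      unfold H1norm
      have : 0 ≤ L2norm (deriv (fun x => gact g (wStar γ s) x - gact g' (wStar γ s) x)) :=
        ENNReal.toReal_nonneg
      linarith
    set N := H1norm (fun x => gact g (wStar γ s) x - gact g' (wStar γ s) x) with hN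
    have h1 := (gc_lower_shift γ s ha0 ha1 g g').trans hle
    have hNc : N ≤ c₁ / 2 := h.trans (min_le_left _ _)
    have hmin : min 1 |g.1 - g'.1| ≤ N / c₁ := by
      rw [le_div_iff₀ hc₁0, mul_comm]; exact h1
    have hlt : N / c₁ ≤ 1 / 2 := by
      rw [div_le_iff₀ hc₁0]; linarith
    have hh1 : |g.1 - g'.1| ≤ 1 := by
      by_contra hcon
      push Not at hcon
      rw [min_eq_left hcon.le] at hmin
      linarith
    rw [min_eq_right hh1] at hmin
    obtain ⟨n, hn⟩ := gc_lower_angle γ s hs2 ha0 ha1 g g' hh1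
    have h2 := hn.trans hle
    refine ⟨n, ?_⟩
    have hb : |g.2 - g'.2 + γ * (g.1 - g'.1) - 2 * Real.pi * n| ≤ N / c₂ := by
      rw [le_div_iff₀ hc₂0, mul_comm]; exact h2
    have hγ1 : |γ| ≤ 1 := abs_le.2 ⟨hγ.1.le, hγ.2.le⟩
    have hγh : |γ * (g.1 - g'.1)| ≤ |g.1 - g'.1| := by
      rw [abs_mul]; exact mul_le_of_le_one_left (abs_nonneg _) hγ1
    have hang : |g.2 - (g'.2 + 2 * Real.pi * n)| ≤ N / c₂ + N / c₁ := by
      have e : g.2 - (g'.2 + 2 * Real.pi * n) =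
        (g.2 - g'.2 + γ * (g.1 - g'.1) - 2 * Real.pi * n) - γ * (g.1 - g'.1) := by ring
      rw [e]
      refine (abs_sub _ _).trans ?_
      linarith
    have hsq : Real.sqrt ((g.1 - g'.1) ^ 2 + (g.2 - (g'.2 + 2 * Real.pi * n)) ^ 2) ≤
        |g.1 - g'.1| + |g.2 - (g'.2 + 2 * Real.pi * n)| := by
      apply Real.sqrt_le_iff.2
      refine ⟨by positivity, ?_⟩
      rw [← sq_abs (g.1 - g'.1), ← sq_abs (g.2 - (g'.2 + 2 * Real.pi * n))]
      nlinarith [abs_nonneg (g.1 - g'.1), abs_nonneg (g.2 - (g'.2 + 2 * Real.pi * n))]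
    have eC : C * N = N / c₁ + (N / c₂ + N / c₁) := by rw [hC]; ring
    rw [eC]
    linarith
  refine ⟨min (c₁ / 2) (1 / C), C, by positivity, hC0, key, ?_⟩
  intro T g g' hg hg' hsm
  by_cases hT : 0 ≤ T
  swap
  · exact ⟨0, fun t ht => absurd (ht.1.trans ht.2) hT⟩
  have near : ∀ t ∈ Set.Icc (0:ℝ) T, ∃ n : ℤ,
      (Real.sqrt (((g t).1 - (g' t).1) ^ 2 + ((g t).2 - ((g' t).2 + 2 * Real.pi * n)) ^ 2)
        ≤ C * H1norm (fun x => gact (g t) (wStar γ s) x - gact (g' t) (wStar γ s) x)) ∧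
      |((g t).2 - (g' t).2) - 2 * Real.pi * n| ≤ 1 := by
    intro t ht
    obtain ⟨n, hn⟩ := key _ _ (hsm t ht)
    refine ⟨n, hn, ?_⟩
    have h1 := (hsm t ht).trans (min_le_right _ _)
    have h2 := mul_le_mul_of_nonneg_left h1 hC0.le
    rw [mul_one_div_cancel hC0.ne'] at h2
    have h3 : |(g t).2 - ((g' t).2 + 2 * Real.pi * n)| ≤
        Real.sqrt (((g t).1 - (g' t).1) ^ 2 + ((g t).2 - ((g' t).2 + 2 * Real.pi * n)) ^ 2) := by
      apply Real.le_sqrt_of_sq_le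
      rw [sq_abs]
      nlinarith [sq_nonneg ((g t).1 - (g' t).1)]
    have e : (g t).2 - (g' t).2 - 2 * Real.pi * n = (g t).2 - ((g' t).2 + 2 * Real.pi * n) := by
      ring
    rw [e]
    linarith
  choose! n hn1 hn2 using near
  have hcont : ContinuousOn (fun t => (g t).2 - (g' t).2) (Set.Icc 0 T) := hg.snd.sub hg'.snd
  have hconst := gc_const T _ hcont n hn2
  refine ⟨n 0, fun t ht => ?_⟩
  rw [← hconst t ht]
  exact hn1 t ht
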